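/- If f and g are nonconstant meromorphic functions on ℂ with g = M ∘ f for a rational function M of degree 2, then T(r,g) = 2T(r,f) + O(1) as r → ∞, where T denotes the Nevanlinna characteristic. -/

import Mathlib

open MeasureTheory intervalIntegral

/-- The spherical (Ahlfors–Shimizu) area function `A(t)` of a meromorphic function. -/
noncomputable def sphericalArea (f : ℂ → ℂ) (t : ℝ) : ℝ :=
  (1 / Real.pi) * ∫ z in Metric.ball (0 : ℂ) t,
    ‖deriv f z‖ ^ 2 / (1 + ‖f z‖ ^ 2) ^ 2

/-- The Ahlfors–Shimizu characteristic `T(r, f)`, which coincides with the Nevanlinna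
characteristic up to a bounded term. -/
noncomputable def charT (f : ℂ → ℂ) (r : ℝ) : ℝ :=
  ∫ t in (0 : ℝ)..r, sphericalArea f t / t

open Complex

noncomputable def lapl (u : ℂ → ℝ) (z : ℂ) : ℝ :=
  fderiv ℝ (fderiv ℝ u) z 1 1 + fderiv ℝ (fderiv ℝ u) z I I

lemma lapl_rot (u : ℂ → ℝ) (z : ℂ) (c s : ℝ) (h : c ^ 2 + s ^ 2 = 1) :
    fderiv ℝ (fderiv ℝ u) z (c + s * I) (c + s * I)
    + fderiv ℝ (fderiv ℝ u) z (I * (c + s * I)) (I * (c + s * I)) = lapl u z := by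
  have e1 : (c + s * I : ℂ) = c • (1 : ℂ) + s • I := by simp
  have e2 : (I * (c + s * I) : ℂ) = (-s) • (1 : ℂ) + c • I := by
    apply Complex.ext <;> simp
  rw [e2, e1]
  simp only [map_add, map_smul, add_apply, smul_apply, smul_eq_mul, lapl]
  linear_combination (fderiv ℝ (fderiv ℝ u) z 1 1 + fderiv ℝ (fderiv ℝ u) z I I) * h

noncomputable def ee (θ : ℝ) : ℂ := exp (θ * I)

lemma ee_cont : Continuous ee := by unfold ee; fun_prop
lemma ee_deriv (θ : ℝ) : HasDerivAt ee (I * ee θ) θ := by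
  have h : HasDerivAt (fun w : ℂ => exp (w * I)) (exp (θ * I) * (1 * I)) (θ : ℂ) :=
    ((hasDerivAt_id (θ : ℂ)).mul_const I).cexp
  have := h.comp_ofReal
  have e : I * ee θ = exp (θ * I) * (1 * I) := by unfold ee; ring
  rw [e]; exact this
lemma lapl_ee (u : ℂ → ℝ) (z : ℂ) (θ : ℝ) :
    fderiv ℝ (fderiv ℝ u) z (ee θ) (ee θ)
    + fderiv ℝ (fderiv ℝ u) z (I * ee θ) (I * ee θ) = lapl u z := by
  have : ee θ = (Real.cos θ : ℂ) + (Real.sin θ : ℂ) * I := by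
    rw [ee, exp_mul_I]; simp
  rw [this]
  exact lapl_rot u z _ _ (Real.cos_sq_add_sin_sq θ)

lemma cont_aux {u : ℂ → ℝ} (hu : ContDiff ℝ 2 u) :
  Continuous (fderiv ℝ u) ∧ Continuous (fderiv ℝ (fderiv ℝ u)) ∧ Differentiable ℝ u ∧ Differentiable ℝ (fderiv ℝ u) := by
  have h1 : ContDiff ℝ 1 (fderiv ℝ u) := hu.fderiv_right (by norm_num)
  exact ⟨h1.continuous, h1.continuous_fderiv (by norm_num), hu.differentiable (by norm_num), h1.differentiable (by norm_num)⟩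

lemma lapl_cont {u : ℂ → ℝ} (hu : ContDiff ℝ 2 u) : Continuous (lapl u) := by
  have := (cont_aux hu).2.1
  unfold lapl
  fun_prop

lemma swap_cont {F : ℝ → ℝ → ℝ} (hF : Continuous (Function.uncurry F)) (a b c d : ℝ) :
    ∫ x in a..b, ∫ y in c..d, F x y = ∫ y in c..d, ∫ x in a..b, F x y := by
  apply MeasureTheory.intervalIntegral_intervalIntegral_swap
  have h := hF.continuousOn.integrableOn_compact (μ := volume) ((isCompact_uIcc (a := a) (b := b)).prod (isCompact_uIcc (a := c) (b := d)))
  exact h.mono_set (Set.prod_mono Set.uIoc_subset_uIcc Set.uIoc_subset_uIcc)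

/-- the circle means -/
lemma mean_eq {u : ℂ → ℝ} (hu : ContDiff ℝ 2 u) (r : ℝ) :
    ∫ t in (0:ℝ)..r, ∫ θ in (-Real.pi)..Real.pi, fderiv ℝ u (t * ee θ) (ee θ)
    = (∫ θ in (-Real.pi)..Real.pi, u (r * ee θ)) - 2 * Real.pi * u 0 := by
  obtain ⟨h1, h2, h3, h4⟩ := cont_aux hu
  have he := ee_cont
  have huc := hu.continuous
  rw [swap_cont (by unfold Function.uncurry; fun_prop)]
  have : ∀ θ : ℝ, ∫ t in (0:ℝ)..r, fderiv ℝ u (t * ee θ) (ee θ) = u (r * ee θ) - u 0 := by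
    intro θ
    rw [integral_eq_sub_of_hasDerivAt (f := fun t : ℝ => u (t * ee θ))]
    · simp
    · intro t _
      have hd : HasDerivAt (fun t : ℝ => (t : ℂ) * ee θ) (1 * ee θ) t := 
        ((hasDerivAt_id t).ofReal_comp).mul_const _
      have := (h3 (t * ee θ)).hasFDerivAt.comp_hasDerivAt t hd
      simpa [Function.comp_def] using this
    · exact Continuous.intervalIntegrable (by fun_prop) _ _
  simp_rw [this]
  rw [intervalIntegral.integral_sub]
  · rw [intervalIntegral.integral_const, smul_eq_mul]; ring
  · exact Continuous.intervalIntegrable (by fun_prop) _ _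
  · simp

lemma flux_eq {u : ℂ → ℝ} (hu : ContDiff ℝ 2 u) (r : ℝ) :
    ∫ t in (0:ℝ)..r, ∫ θ in (-Real.pi)..Real.pi, t * lapl u (t * ee θ)
    = r * ∫ θ in (-Real.pi)..Real.pi, fderiv ℝ u (r * ee θ) (ee θ) := by
  obtain ⟨h1, h2, h3, h4⟩ := cont_aux hu
  have he := ee_cont
  have huc := hu.continuous
  have hl := lapl_cont hu
  have key : ∀ t : ℝ, ∫ θ in (-Real.pi)..Real.pi, t * lapl u (t * ee θ) = 
     ∫ θ in (-Real.pi)..Real.pi, (t * fderiv ℝ (fderiv ℝ u) (t * ee θ) (ee θ) (ee θ) + fderiv ℝ u (t * ee θ) (ee θ)) := by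
    intro t
    rw [← sub_eq_zero, ← intervalIntegral.integral_sub]
    · have hp : ee Real.pi = ee (-Real.pi) := by simp [ee, Complex.exp_neg]
      have : (∫ θ in (-Real.pi)..Real.pi, (t * fderiv ℝ (fderiv ℝ u) (t * ee θ) (I * ee θ) (I * ee θ) - fderiv ℝ u (t * ee θ) (ee θ))) = 0 := by
        rw [integral_eq_sub_of_hasDerivAt (f := fun θ : ℝ => fderiv ℝ u (t * ee θ) (I * ee θ))]
        · rw [hp]; simp
        · intro θ _
          have hd : HasDerivAt (fun θ : ℝ => (t : ℂ) * ee θ) (t * (I * ee θ)) θ := (ee_deriv θ).const_mul _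
          have hd2 : HasDerivAt (fun θ : ℝ => I * ee θ) (I * (I * ee θ)) θ := (ee_deriv θ).const_mul _
          have hA : HasDerivAt (fun θ : ℝ => fderiv ℝ u (t * ee θ))
              (fderiv ℝ (fderiv ℝ u) (t * ee θ) (t * (I * ee θ))) θ :=
            (h4 (t * ee θ)).hasFDerivAt.comp_hasDerivAt θ hd
          have hB := hA.clm_apply hd2
          refine hB.congr_deriv ?_
          have e1 : (t * (I * ee θ) : ℂ) = t • (I * ee θ) := by simp
          have e2 : (I * (I * ee θ) : ℂ) = - ee θ := by rw [← mul_assoc]; simp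
          rw [e2, e1, map_smul, map_neg, smul_apply, smul_eq_mul]
          ring
        · exact Continuous.intervalIntegrable (by fun_prop) _ _
      rw [← this]
      congr 1; ext θ
      rw [← lapl_ee u _ θ]; ring
    · exact Continuous.intervalIntegrable (by fun_prop) _ _
    · exact Continuous.intervalIntegrable (by fun_prop) _ _
  simp_rw [key]
  rw [swap_cont (by unfold Function.uncurry; fun_prop), ← intervalIntegral.integral_const_mul]
  congr 1; ext θ
  rw [integral_eq_sub_of_hasDerivAt (f := fun t : ℝ => t * fderiv ℝ u (t * ee θ) (ee θ))]
  · simp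
  · intro t _
    have hd : HasDerivAt (fun t : ℝ => (t : ℂ) * ee θ) (1 * ee θ) t := 
        ((hasDerivAt_id t).ofReal_comp).mul_const _
    have hA : HasDerivAt (fun t : ℝ => fderiv ℝ u (t * ee θ))
              (fderiv ℝ (fderiv ℝ u) (t * ee θ) (1 * ee θ)) t :=
            (h4 (t * ee θ)).hasFDerivAt.comp_hasDerivAt t hd
    have hB := hA.clm_apply (hasDerivAt_const t (ee θ))
    have hC := (hasDerivAt_id' t).mul hB
    refine hC.congr_deriv ?_
    rw [map_zero, one_mul]
    ring
  · exact Continuous.intervalIntegrable (by fun_prop) _ _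

lemma polar_ball {v : ℂ → ℝ} (hv : Continuous v) {r : ℝ} (hr : 0 ≤ r) :
    ∫ z in Metric.ball (0:ℂ) r, v z = ∫ t in (0:ℝ)..r, ∫ θ in (-Real.pi)..Real.pi, t * v (t * ee θ) := by
  have he := ee_cont
  rw [← MeasureTheory.integral_indicator measurableSet_ball, ← Complex.integral_comp_polarCoord_symm]
  rw [polarCoord_target]
  have hpi : -Real.pi ≤ Real.pi := by linarith [Real.pi_pos]
  rw [intervalIntegral.integral_of_le hr, integral_Ioc_eq_integral_Ioo]
  simp_rw [intervalIntegral.integral_of_le hpi, integral_Ioc_eq_integral_Ioo]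
  rw [← setIntegral_prod (fun p : ℝ × ℝ => p.1 * v (p.1 * ee p.2))]
  · rw [← MeasureTheory.integral_indicator (measurableSet_Ioi.prod measurableSet_Ioo), ← MeasureTheory.integral_indicator (measurableSet_Ioo.prod measurableSet_Ioo)]
    congr 1; ext p
    have hs : Complex.polarCoord.symm p = p.1 * ee p.2 := by
      rw [Complex.polarCoord_symm_apply, ee, exp_mul_I]; simp
    have hn : ‖ee p.2‖ = 1 := by simp [ee, Complex.norm_exp_ofReal_mul_I]
    simp only [Set.indicator, hs, Set.mem_prod, Set.mem_Ioi, Set.mem_Ioo, Metric.mem_ball, dist_zero_right, norm_mul, hn, norm_real, Real.norm_eq_abs, mul_one, smul_eq_mul]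
    by_cases h0 : 0 < p.1
    · by_cases h1 : p.1 < r <;> simp [h0, h1, abs_of_pos]
    · simp [h0]
  · apply (Continuous.continuousOn (by fun_prop) : ContinuousOn _ (Set.Icc 0 r ×ˢ Set.Icc (-Real.pi) Real.pi)).integrableOn_compact (isCompact_Icc.prod isCompact_Icc) |>.mono_set
    exact Set.prod_mono Set.Ioo_subset_Icc_self Set.Ioo_subset_Icc_self

lemma green {u : ℂ → ℝ} (hu : ContDiff ℝ 2 u) {r : ℝ} (hr : 0 ≤ r) :
    ∫ z in Metric.ball (0:ℂ) r, lapl u z = r * ∫ θ in (-Real.pi)..Real.pi, fderiv ℝ u (r * ee θ) (ee θ) := by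
  rw [polar_ball (lapl_cont hu) hr, flux_eq hu]

open Filter Topology

noncomputable def NN (P Q : ℂ → ℂ) (z : ℂ) : ℝ := normSq (P z) + normSq (Q z)
noncomputable def LL (P Q : ℂ → ℂ) (z : ℂ) : ℝ := Real.log (NN P Q z)

lemma normSq_contDiff {n : WithTop ℕ∞} : ContDiff ℝ n (fun w : ℂ => normSq w) := by
  have : (fun w : ℂ => normSq w) = fun w : ℂ => ‖w‖ ^ 2 := by
    ext w; exact normSq_eq_norm_sq w
  rw [this]
  exact contDiff_norm_sq ℝ

lemma NN_pos {P Q : ℂ → ℂ} {z : ℂ} (h : P z ≠ 0 ∨ Q z ≠ 0) : 0 < NN P Q z := by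
  unfold NN
  rcases h with h | h
  · have := normSq_pos.2 h; have := normSq_nonneg (Q z); linarith
  · have := normSq_pos.2 h; have := normSq_nonneg (P z); linarith

lemma LL_contDiffAt {P Q : ℂ → ℂ} {z : ℂ} (hP : ContDiffAt ℝ 2 P z) (hQ : ContDiffAt ℝ 2 Q z)
    (h : P z ≠ 0 ∨ Q z ≠ 0) : ContDiffAt ℝ 2 (LL P Q) z := by
  have h1 : ContDiffAt ℝ 2 (NN P Q) z :=
    (normSq_contDiff.contDiffAt.comp z hP).add (normSq_contDiff.contDiffAt.comp z hQ)
  exact h1.log (NN_pos h).ne'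

lemma normSq_line {P : ℝ → ℂ} {P' : ℂ} {s : ℝ} (h : HasDerivAt P P' s) :
    HasDerivAt (fun s => normSq (P s)) (2 * ((starRingEnd ℂ) (P s) * P').re) s := by
  have hr : HasDerivAt (fun s => (P s).re) P'.re s := by
    simpa [Function.comp_def] using reCLM.hasFDerivAt.comp_hasDerivAt s h
  have hi : HasDerivAt (fun s => (P s).im) P'.im s := by
    simpa [Function.comp_def] using imCLM.hasFDerivAt.comp_hasDerivAt s h
  have := (hr.mul hr).add (hi.mul hi)
  simp only [normSq_apply]
  refine this.congr_deriv ?_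
  simp; ring

lemma line_deriv {P : ℂ → ℂ} {z e : ℂ} {s : ℝ} (h : DifferentiableAt ℂ P (z + s * e)) :
    HasDerivAt (fun s : ℝ => P (z + s * e)) (deriv P (z + s * e) * e) s := by
  have hd : HasDerivAt (fun t : ℝ => z + (t : ℂ) * e) (1 * e) s := 
    (((hasDerivAt_id s).ofReal_comp).mul_const e).const_add z
  have := h.hasDerivAt.comp s hd
  simpa [Function.comp_def] using this

lemma LL_fderiv {P Q : ℂ → ℂ} {z : ℂ} (hP : AnalyticAt ℂ P z) (hQ : AnalyticAt ℂ Q z)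
    (h : P z ≠ 0 ∨ Q z ≠ 0) (e : ℂ) : fderiv ℝ (LL P Q) z e =
     2 * (((starRingEnd ℂ) (P z) * deriv P z + (starRingEnd ℂ) (Q z) * deriv Q z) * e).re / NN P Q z := by
  have hd : DifferentiableAt ℝ (LL P Q) z :=
    (LL_contDiffAt (hP.contDiffAt.restrict_scalars ℝ) (hQ.contDiffAt.restrict_scalars ℝ) h).differentiableAt (by norm_num)
  have h0 : z + ((0:ℝ) : ℂ) * e = z := by simp
  have hl : HasDerivAt (fun t : ℝ => z + (t : ℂ) * e) (1 * e) 0 := 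
    (((hasDerivAt_id (0:ℝ)).ofReal_comp).mul_const e).const_add z
  have h1 : HasDerivAt (fun s : ℝ => LL P Q (z + s * e)) (fderiv ℝ (LL P Q) z e) 0 := by
    have hd' : HasFDerivAt (LL P Q) (fderiv ℝ (LL P Q) z) (z + ((0:ℝ) : ℂ) * e) := by
      rw [h0]; exact hd.hasFDerivAt
    simpa [Function.comp_def] using hd'.comp_hasDerivAt (0:ℝ) hl
  have hP' := line_deriv (P := P) (z := z) (e := e) (s := 0) (by rw [h0]; exact hP.differentiableAt)
  have hQ' := line_deriv (P := Q) (z := z) (e := e) (s := 0) (by rw [h0]; exact hQ.differentiableAt)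
  have h2 := (((normSq_line hP').add (normSq_line hQ')).log (by
    have := (NN_pos h).ne'; simpa [NN] using this))
  rw [h1.unique h2]
  simp only [h0, NN, Pi.add_apply]
  rw [add_mul, add_re, mul_assoc, mul_assoc]; ring

lemma conj_line {P : ℝ → ℂ} {P' : ℂ} {s : ℝ} (h : HasDerivAt P P' s) :
    HasDerivAt (fun s => (starRingEnd ℂ) (P s)) ((starRingEnd ℂ) P') s := by
  simpa [Function.comp_def] using (conjCLE.toContinuousLinearMap).hasFDerivAt.comp_hasDerivAt s h

lemma LL_second {P Q : ℂ → ℂ} {z : ℂ} (hP : AnalyticAt ℂ P z) (hQ : AnalyticAt ℂ Q z)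
    (h : P z ≠ 0 ∨ Q z ≠ 0) (e : ℂ) : fderiv ℝ (fderiv ℝ (LL P Q)) z e e =
     (2 * (normSq (deriv P z) + normSq (deriv Q z)) * normSq e +
      2 * (((starRingEnd ℂ) (P z) * deriv (deriv P) z + (starRingEnd ℂ) (Q z) * deriv (deriv Q) z) * (e * e)).re) / NN P Q z
     - (2 * (((starRingEnd ℂ) (P z) * deriv P z + (starRingEnd ℂ) (Q z) * deriv Q z) * e).re / NN P Q z) ^ 2 := by
  have hc := LL_contDiffAt (hP.contDiffAt.restrict_scalars ℝ) (hQ.contDiffAt.restrict_scalars ℝ) h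
  have hd : DifferentiableAt ℝ (fderiv ℝ (LL P Q)) z :=
    (hc.fderiv_right (m := 1) (by norm_num)).differentiableAt (by norm_num)
  have h0 : z + ((0:ℝ) : ℂ) * e = z := by simp
  have hl : HasDerivAt (fun t : ℝ => z + (t : ℂ) * e) (1 * e) 0 := 
    (((hasDerivAt_id (0:ℝ)).ofReal_comp).mul_const e).const_add z
  have h1 : HasDerivAt (fun s : ℝ => fderiv ℝ (LL P Q) (z + s * e) e) (fderiv ℝ (fderiv ℝ (LL P Q)) z e e) 0 := by
    have hd' : HasFDerivAt (fderiv ℝ (LL P Q)) (fderiv ℝ (fderiv ℝ (LL P Q)) z) (z + ((0:ℝ) : ℂ) * e) := by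
      rw [h0]; exact hd.hasFDerivAt
    have hA : HasDerivAt (fun s : ℝ => fderiv ℝ (LL P Q) (z + s * e)) (fderiv ℝ (fderiv ℝ (LL P Q)) z (1 * e)) 0 := hd'.comp_hasDerivAt (0:ℝ) hl
    have hB := hA.clm_apply (hasDerivAt_const (0:ℝ) e)
    refine hB.congr_deriv ?_
    rw [map_zero, one_mul, add_zero]
  have hev : ∀ᶠ w in 𝓝 z, AnalyticAt ℂ P w ∧ AnalyticAt ℂ Q w ∧ (P w ≠ 0 ∨ Q w ≠ 0) := by
    refine hP.eventually_analyticAt.and (hQ.eventually_analyticAt.and ?_)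
    rcases h with h | h
    · exact (hP.continuousAt.eventually_ne h).mono fun w hw => Or.inl hw
    · exact (hQ.continuousAt.eventually_ne h).mono fun w hw => Or.inr hw
  have htend : Tendsto (fun s : ℝ => z + (s : ℂ) * e) (𝓝 0) (𝓝 z) := by
    have : Continuous (fun s : ℝ => z + (s : ℂ) * e) := by fun_prop
    have := this.tendsto 0
    rwa [h0] at this
  have hev2 := htend.eventually hev
  have hP' := line_deriv (P := P) (z := z) (e := e) (s := 0) (by rw [h0]; exact hP.differentiableAt)
  have hQ' := line_deriv (P := Q) (z := z) (e := e) (s := 0) (by rw [h0]; exact hQ.differentiableAt)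
  have hP'' := line_deriv (P := deriv P) (z := z) (e := e) (s := 0) (by rw [h0]; exact hP.deriv.differentiableAt)
  have hQ'' := line_deriv (P := deriv Q) (z := z) (e := e) (s := 0) (by rw [h0]; exact hQ.deriv.differentiableAt)
  have hN := (normSq_line hP').add (normSq_line hQ')
  have hS := ((((conj_line hP').mul hP'').add ((conj_line hQ').mul hQ'')).mul_const e)
  have hSr := reCLM.hasFDerivAt.comp_hasDerivAt (0:ℝ) hS
  have hpos := NN_pos h
  have h2 := (hSr.const_mul 2).div hN (by simpa [NN] using hpos.ne')
  have h3 := h2.congr_of_eventuallyEq (f₁ := fun s : ℝ => fderiv ℝ (LL P Q) (z + s * e) e) (by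
    filter_upwards [hev2] with s hs
    rw [LL_fderiv hs.1 hs.2.1 hs.2.2]
    simp [NN])
  rw [h1.unique h3]
  simp only [h0, Pi.add_apply, Pi.mul_apply, Function.comp_apply, reCLM_apply]
  have hN0 : normSq (P z) + normSq (Q z) ≠ 0 := hpos.ne'
  unfold NN
  simp only [normSq_apply, map_mul, mul_re, mul_im, add_re, add_im, conj_re, conj_im] at hN0 ⊢
  field_simp
  ring

lemma LL_lapl {P Q : ℂ → ℂ} {z : ℂ} (hP : AnalyticAt ℂ P z) (hQ : AnalyticAt ℂ Q z)
    (h : P z ≠ 0 ∨ Q z ≠ 0) : lapl (LL P Q) z =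
     4 * normSq (deriv P z * Q z - P z * deriv Q z) / (NN P Q z) ^ 2 := by
  rw [lapl, LL_second hP hQ h, LL_second hP hQ h, I_mul_I, one_mul]
  have hpos := NN_pos h
  have hN0 : normSq (P z) + normSq (Q z) ≠ 0 := hpos.ne'
  unfold NN
  field_simp
  simp only [normSq_apply, mul_re, mul_im, add_re, add_im, sub_re, sub_im, neg_re, conj_re, conj_im, I_re, I_im, one_re, one_im]
  ring

noncomputable def HH (P Q : ℂ → ℂ) (w : ℂ) : ℝ := LL P Q w - 2 * LL (fun w => w) (fun _ => 1) w

lemma HH_contDiff {P Q : ℂ → ℂ} (hP : ContDiff ℝ 2 P) (hQ : ContDiff ℝ 2 Q)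
    (h : ∀ z, P z ≠ 0 ∨ Q z ≠ 0) : ContDiff ℝ 2 (HH P Q) := by
  rw [contDiff_iff_contDiffAt]
  intro z
  refine (LL_contDiffAt hP.contDiffAt hQ.contDiffAt (h z)).sub (contDiffAt_const.mul ?_)
  exact LL_contDiffAt contDiffAt_id contDiffAt_const (Or.inr one_ne_zero)

noncomputable def rv (p : Polynomial ℂ) (v : ℂ) : ℂ := p.coeff 0 * v ^ 2 + p.coeff 1 * v + p.coeff 2

lemma eval_deg2 {p : Polynomial ℂ} (hp : p.natDegree ≤ 2) (w : ℂ) :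
    p.eval w = p.coeff 0 + p.coeff 1 * w + p.coeff 2 * w ^ 2 := by
  rw [Polynomial.eval_eq_sum_range' (n := 3) (by omega)]
  simp [Finset.sum_range_succ]

lemma rv_eq {p : Polynomial ℂ} (hp : p.natDegree ≤ 2) {v : ℂ} (hv : v ≠ 0) :
    rv p v = v ^ 2 * p.eval v⁻¹ := by
  rw [eval_deg2 hp, rv]; field_simp

lemma no_common {p q : Polynomial ℂ} (hcop : IsCoprime p q) (z : ℂ) : p.eval z ≠ 0 ∨ q.eval z ≠ 0 := by
  obtain ⟨a, b, hab⟩ := hcop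
  by_contra! h
  have := congrArg (Polynomial.eval z) hab
  simp [h.1, h.2] at this

lemma no_common_rv {p q : Polynomial ℂ} (hcop : IsCoprime p q)
    (hdeg : max p.natDegree q.natDegree = 2) (z : ℂ) : rv p z ≠ 0 ∨ rv q z ≠ 0 := by
  have hp : p.natDegree ≤ 2 := hdeg ▸ le_max_left _ _
  have hq : q.natDegree ≤ 2 := hdeg ▸ le_max_right _ _
  by_cases hz : z = 0
  · subst hz
    have hl : ∀ s : Polynomial ℂ, s.natDegree = 2 → s.coeff 2 ≠ 0 := by
      intro s hs
      rw [← hs, Polynomial.coeff_natDegree, Polynomial.leadingCoeff_ne_zero]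
      rintro rfl; simp at hs
    rcases max_choice p.natDegree q.natDegree with h | h
    · left; simpa [rv] using hl p (by omega)
    · right; simpa [rv] using hl q (by omega)
  · rw [rv_eq hp hz, rv_eq hq hz]
    have := no_common hcop z⁻¹
    simpa [hz] using this

lemma HH_inv {p q : Polynomial ℂ} (hcop : IsCoprime p q)
    (hdeg : max p.natDegree q.natDegree = 2) {v : ℂ} (hv : v ≠ 0) :
    HH (rv p) (rv q) v = HH (fun w => p.eval w) (fun w => q.eval w) v⁻¹ := by
  have hp : p.natDegree ≤ 2 := hdeg ▸ le_max_left _ _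
  have hq : q.natDegree ≤ 2 := hdeg ▸ le_max_right _ _
  have hn : 0 < normSq v := normSq_pos.2 hv
  have h1 : NN (rv p) (rv q) v = normSq v ^ 2 * NN (fun w => p.eval w) (fun w => q.eval w) v⁻¹ := by
    simp only [NN, rv_eq hp hv, rv_eq hq hv, map_mul, map_pow]; ring
  have h2 : NN (fun w => w) (fun _ => 1) v = normSq v * NN (fun w => w) (fun _ => 1) v⁻¹ := by
    simp only [NN, map_inv₀, map_one]; field_simp; ring
  have h3 := NN_pos (P := fun w => p.eval w) (Q := fun w => q.eval w) (no_common hcop v⁻¹)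
  have h4 := NN_pos (P := fun w => w) (Q := fun _ => 1) (z := v⁻¹) (Or.inr one_ne_zero)
  rw [HH, HH, LL, LL, LL, LL, h1, h2, Real.log_mul (by positivity) h3.ne', Real.log_mul hn.ne' h4.ne', Real.log_pow]
  push_cast; ring

lemma eval_contDiff (p : Polynomial ℂ) : ContDiff ℝ 2 (fun w : ℂ => p.eval w) := by
  have : ContDiff ℂ 2 (fun w : ℂ => p.eval w) := by
    simpa using p.contDiff_aeval (𝕜 := ℂ) (R := ℂ) 2
  exact this.restrict_scalars ℝ

lemma rv_contDiff (p : Polynomial ℂ) : ContDiff ℝ 2 (rv p) := by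
  unfold rv; fun_prop

lemma HH_bdd {p q : Polynomial ℂ} (hcop : IsCoprime p q)
    (hdeg : max p.natDegree q.natDegree = 2) :
    ∃ B : ℝ, ∀ w, |HH (fun w => p.eval w) (fun w => q.eval w) w| ≤ B := by
  have c1 := (HH_contDiff (eval_contDiff p) (eval_contDiff q) (no_common hcop)).continuous
  have c2 := (HH_contDiff (rv_contDiff p) (rv_contDiff q) (no_common_rv hcop hdeg)).continuous
  obtain ⟨B1, hB1⟩ := (isCompact_closedBall (0:ℂ) 1).exists_bound_of_continuousOn c1.continuousOn
  obtain ⟨B2, hB2⟩ := (isCompact_closedBall (0:ℂ) 1).exists_bound_of_continuousOn c2.continuousOn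
  refine ⟨max B1 B2, fun w => ?_⟩
  by_cases hw : ‖w‖ ≤ 1
  · exact (hB1 w (by simpa using hw)).trans (le_max_left _ _)
  · push Not at hw
    have hw0 : w ≠ 0 := by rintro rfl; simp at hw; linarith
    have := HH_inv hcop hdeg (inv_ne_zero hw0)
    rw [inv_inv] at this
    rw [← this]
    refine (hB2 w⁻¹ ?_).trans (le_max_right _ _)
    simpa using inv_le_one_of_one_le₀ hw.le

lemma mero_loc {f : ℂ → ℂ} {z₀ : ℂ} (hf : MeromorphicAt f z₀) :
    ∃ a : ℂ → ℂ, AnalyticAt ℂ a z₀ ∧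
      ((∀ᶠ z in 𝓝[≠] z₀, f z = a z) ∨ (∀ᶠ z in 𝓝[≠] z₀, f z = (a z)⁻¹ ∧ a z ≠ 0)) := by
  by_cases h : 0 ≤ meromorphicOrderAt f z₀
  · obtain ⟨a, ha, hfa⟩ := (hf.meromorphicOrderAt_nonneg_iff).1 h
    exact ⟨a, ha, Or.inl hfa⟩
  · push Not at h
    have h' : 0 ≤ meromorphicOrderAt f⁻¹ z₀ := by
      rw [meromorphicOrderAt_inv]
      cases hm : meromorphicOrderAt f z₀ with
      | top => simp
      | coe n =>
        rw [hm] at h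
        have : n < 0 := by exact_mod_cast h
        have : 0 ≤ -n := by omega
        exact_mod_cast this
    obtain ⟨a, ha, hfa⟩ := (hf.inv.meromorphicOrderAt_nonneg_iff).1 h'
    have hne := (meromorphicOrderAt_ne_top_iff_eventually_ne_zero hf).1 (ne_top_of_lt h)
    refine ⟨a, ha, Or.inr ?_⟩
    filter_upwards [hfa, hne] with z h1 h2
    rw [← h1]; simp [h2]

lemma ev_punct {z₀ : ℂ} {p : ℂ → Prop} (h : ∀ᶠ z in 𝓝[≠] z₀, p z) :
    ∀ᶠ z in 𝓝[≠] z₀, ∀ᶠ w in 𝓝 z, p w := by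
  have h1 := eventually_eventually_nhdsWithin.2 h
  filter_upwards [h1, self_mem_nhdsWithin] with z hz hz'
  rwa [isOpen_compl_singleton.nhdsWithin_eq hz'] at hz

lemma ev_ae {p : ℂ → Prop} (h : ∀ z₀, ∀ᶠ z in 𝓝[≠] z₀, p z) : ∀ᵐ z, p z := by
  have hc : ({z | ¬ p z}).Countable := by
    apply (HereditarilyLindelofSpace.isLindelof _).countable_of_isDiscrete
    rw [← Set.inter_univ {z | ¬ p z}]
    apply isDiscrete_of_codiscreteWithin
    rw [mem_codiscreteWithin_iff_forall_mem_nhdsNE]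
    intro z _
    refine mem_of_superset (h z) fun w hw => ?_
    have hw' : p w := hw
    simp [hw']
  exact hc.ae_notMem volume |>.mono fun z hz => by simpa using hz

lemma sph_bound {f : ℂ → ℂ} {z₀ : ℂ} (hf : MeromorphicAt f z₀) :
    ∃ C : ℝ, ∀ᶠ z in 𝓝[≠] z₀, ‖deriv f z‖ ^ 2 / (1 + ‖f z‖ ^ 2) ^ 2 ≤ C := by
  obtain ⟨a, ha, h⟩ := mero_loc hf
  have hb : ∀ᶠ z in 𝓝[≠] z₀, ‖deriv a z‖ ^ 2 < ‖deriv a z₀‖ ^ 2 + 1 :=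
    (((ha.deriv.continuousAt.norm.pow 2).eventually_lt_const (lt_add_one _))).filter_mono nhdsWithin_le_nhds
  have hsmall : ∀ x y : ℝ, 0 ≤ x → x / (1 + y ^ 2) ^ 2 ≤ x := by
    intro x y hx
    apply div_le_self hx
    nlinarith [sq_nonneg y, sq_nonneg (y^2)]
  refine ⟨‖deriv a z₀‖ ^ 2 + 1, ?_⟩
  have haa : ∀ᶠ z in 𝓝[≠] z₀, AnalyticAt ℂ a z := ha.eventually_analyticAt.filter_mono nhdsWithin_le_nhds
  rcases h with h | h
  · filter_upwards [ev_punct h, hb] with z hz hbz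
    have hz' : f =ᶠ[𝓝 z] a := hz
    rw [hz'.deriv_eq]
    exact (hsmall _ _ (by positivity)).trans hbz.le
  · filter_upwards [ev_punct h, hb, h, haa] with z hz hbz hz2 haz
    have hz' : f =ᶠ[𝓝 z] fun w => (a w)⁻¹ := hz.mono fun w hw => hw.1
    rw [hz'.deriv_eq, hz2.1]
    have hd := (haz.differentiableAt.hasDerivAt.fun_inv hz2.2).deriv
    rw [hd]
    have hpos : 0 < ‖a z‖ := norm_pos_iff.2 hz2.2
    have : ‖-deriv a z / a z ^ 2‖ ^ 2 / (1 + ‖(a z)⁻¹‖ ^ 2) ^ 2 = ‖deriv a z‖ ^ 2 / (1 + ‖a z‖ ^ 2) ^ 2 := by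
      rw [norm_div, norm_neg, norm_pow, norm_inv]
      field_simp
      ring
    rw [this]
    exact (hsmall _ _ (by positivity)).trans hbz.le

lemma smooth_ext {v : ℂ → ℝ} (h : ∀ z₀, ∃ φ : ℂ → ℝ, ContDiffAt ℝ 2 φ z₀ ∧ v =ᶠ[𝓝[≠] z₀] φ) :
    ∃ u : ℂ → ℝ, ContDiff ℝ 2 u ∧ ∀ z₀, v =ᶠ[𝓝[≠] z₀] u := by
  choose φ hφ hv using h
  have key : ∀ z₀, (fun z => φ z z) =ᶠ[𝓝 z₀] φ z₀ := by
    intro z₀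
    have h1 : ∀ᶠ z in 𝓝[≠] z₀, φ z z = φ z₀ z := by
      have hc : ∀ᶠ z in 𝓝 z₀, ContDiffAt ℝ 2 (φ z₀) z := (hφ z₀).eventually (by simp)
      filter_upwards [ev_punct (hv z₀), hc.filter_mono nhdsWithin_le_nhds] with z hz hcz
      have e : φ z =ᶠ[𝓝[≠] z] φ z₀ := (hv z).symm.trans (hz.filter_mono nhdsWithin_le_nhds)
      have t1 : Tendsto (φ z) (𝓝[≠] z) (𝓝 (φ z z)) := (hφ z).continuousAt.continuousWithinAt
      have t2 : Tendsto (φ z₀) (𝓝[≠] z) (𝓝 (φ z₀ z)) := hcz.continuousAt.continuousWithinAt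
      exact tendsto_nhds_unique t1 (t2.congr' e.symm)
    rw [eventually_nhdsWithin_iff] at h1
    filter_upwards [h1] with z hz
    by_cases hzz : z = z₀
    · rw [hzz]
    · exact hz hzz
  refine ⟨fun z => φ z z, ?_, fun z₀ => (hv z₀).trans ((key z₀).symm.filter_mono nhdsWithin_le_nhds)⟩
  rw [contDiff_iff_contDiffAt]
  intro z₀
  exact (hφ z₀).congr_of_eventuallyEq (key z₀)

lemma lapl_congr {u v : ℂ → ℝ} {z : ℂ} (h : u =ᶠ[𝓝 z] v) : lapl u z = lapl v z := by
  have h2 : fderiv ℝ (fderiv ℝ u) z = fderiv ℝ (fderiv ℝ v) z := (h.fderiv (𝕜 := ℝ)).fderiv_eq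
  rw [lapl, lapl, h2]

lemma lapl_sub {A B : ℂ → ℝ} {z : ℂ} (hA : ContDiffAt ℝ 2 A z) (hB : ContDiffAt ℝ 2 B z) :
    lapl (fun w => A w - 2 * B w) z = lapl A z - 2 * lapl B z := by
  have hev : fderiv ℝ (fun w => A w - 2 * B w) =ᶠ[𝓝 z] fun w => fderiv ℝ A w - (2:ℝ) • fderiv ℝ B w := by
    filter_upwards [hA.eventually (by simp), hB.eventually (by simp)] with w h1 h2
    have d1 := (h1.differentiableAt (by norm_num)).hasFDerivAt
    have d2 := (h2.differentiableAt (by norm_num)).hasFDerivAt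
    exact (d1.sub (d2.const_mul 2)).fderiv
  have dA := ((hA.fderiv_right (m := 1) (by norm_num)).differentiableAt (by norm_num)).hasFDerivAt
  have dB := ((hB.fderiv_right (m := 1) (by norm_num)).differentiableAt (by norm_num)).hasFDerivAt
  have h2 : fderiv ℝ (fderiv ℝ (fun w => A w - 2 * B w)) z
      = fderiv ℝ (fderiv ℝ A) z - (2:ℝ) • fderiv ℝ (fderiv ℝ B) z := by
    rw [hev.fderiv_eq]
    exact (dA.sub (dB.const_smul (2:ℝ))).fderiv
  rw [lapl, h2, lapl, lapl]
  simp only [sub_apply, smul_apply, smul_eq_mul]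
  ring

noncomputable def sph (f : ℂ → ℂ) (z : ℂ) : ℝ := ‖deriv f z‖ ^ 2 / (1 + ‖f z‖ ^ 2) ^ 2

lemma lapl_HH {f : ℂ → ℂ} {p q : Polynomial ℂ} (hcop : IsCoprime p q) {z : ℂ} (hf : AnalyticAt ℂ f z) :
    lapl (fun w => HH (fun w => p.eval w) (fun w => q.eval w) (f w)) z =
      4 * normSq (deriv (fun w => p.eval (f w)) z * q.eval (f z) - p.eval (f z) * deriv (fun w => q.eval (f w)) z)
        / (NN (fun w => p.eval (f w)) (fun w => q.eval (f w)) z) ^ 2 - 8 * sph f z := by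
  have hev : ∀ s : Polynomial ℂ, AnalyticAt ℂ (fun w => s.eval (f w)) z := by
    intro s
    simpa using hf.aeval_polynomial s
  have e : (fun w => HH (fun w => p.eval w) (fun w => q.eval w) (f w)) =
     fun w => LL (fun w => p.eval (f w)) (fun w => q.eval (f w)) w - 2 * LL f (fun _ => 1) w := rfl
  have c1 := LL_contDiffAt ((hev p).contDiffAt.restrict_scalars ℝ) ((hev q).contDiffAt.restrict_scalars ℝ) (no_common hcop (f z))
  have c2 := LL_contDiffAt (hf.contDiffAt.restrict_scalars ℝ) (contDiffAt_const (c := (1:ℂ))) (Or.inr one_ne_zero)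
  rw [e, lapl_sub c1 c2, LL_lapl (hev p) (hev q) (no_common hcop (f z)), LL_lapl hf analyticAt_const (Or.inr one_ne_zero)]
  have : sph f z = normSq (deriv f z * 1 - f z * deriv (fun _ => (1:ℂ)) z) / NN f (fun _ => 1) z ^ 2 := by
    simp [sph, NN, normSq_eq_norm_sq, add_comm]
  rw [this]; ring

lemma sph_g_ne {P Q : ℂ → ℂ} {g : ℂ → ℂ} {z : ℂ} (hP : AnalyticAt ℂ P z) (hQ : AnalyticAt ℂ Q z)
    (hg : ∀ w, g w = P w / Q w) (h : Q z ≠ 0) :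
    sph g z = normSq (deriv P z * Q z - P z * deriv Q z) / (NN P Q z) ^ 2 := by
  have : g = fun w => P w / Q w := funext hg
  have hd := (hP.differentiableAt.hasDerivAt.fun_div hQ.differentiableAt.hasDerivAt h).deriv
  rw [sph, this, hd, NN, normSq_eq_norm_sq, normSq_eq_norm_sq, normSq_eq_norm_sq, norm_div, norm_div, norm_pow]
  have hpos : 0 < ‖Q z‖ := norm_pos_iff.2 h
  field_simp
  ring

lemma exists_u {f g : ℂ → ℂ} {p q : Polynomial ℂ}
    (hf : MeromorphicOn f Set.univ) (hcop : IsCoprime p q)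
    (hdeg : max p.natDegree q.natDegree = 2)
    (hg : ∀ z : ℂ, g z = p.eval (f z) / q.eval (f z)) :
    ∃ u : ℂ → ℝ, ∃ B : ℝ, ContDiff ℝ 2 u ∧ (∀ z, |u z| ≤ B) ∧ ∀ᵐ z, sph g z = 2 * sph f z + lapl u z / 4 := by
  set v : ℂ → ℝ := fun w => HH (fun w => p.eval w) (fun w => q.eval w) (f w) with hv
  have c1 := (HH_contDiff (eval_contDiff p) (eval_contDiff q) (no_common hcop))
  have c2 := (HH_contDiff (rv_contDiff p) (rv_contDiff q) (no_common_rv hcop hdeg))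
  obtain ⟨u, hu, huv⟩ := smooth_ext (v := v) (by
    intro z₀
    obtain ⟨a, ha, h | h⟩ := mero_loc (hf z₀ trivial)
    · refine ⟨fun z => HH (fun w => p.eval w) (fun w => q.eval w) (a z), 
        c1.contDiffAt.comp z₀ (ha.contDiffAt.restrict_scalars ℝ), ?_⟩
      filter_upwards [h] with z hz
      simp only [hv, hz]
    · refine ⟨fun z => HH (rv p) (rv q) (a z), 
        c2.contDiffAt.comp z₀ (ha.contDiffAt.restrict_scalars ℝ), ?_⟩
      filter_upwards [h] with z hz
      simp only [hv, hz.1, HH_inv hcop hdeg hz.2])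
  obtain ⟨B, hB⟩ := HH_bdd hcop hdeg
  refine ⟨u, B, hu, ?_, ?_⟩
  · intro z
    have t : Tendsto u (𝓝[≠] z) (𝓝 (u z)) := hu.continuous.continuousAt.continuousWithinAt
    refine le_of_tendsto t.abs ?_
    filter_upwards [huv z] with w hw
    rw [← hw]; exact hB _
  · apply ev_ae
    intro z₀
    have hmq : MeromorphicAt (fun w => q.eval (f w)) z₀ := by
      have := hf z₀ trivial
      simp only [Polynomial.eval_eq_sum_range]
      fun_prop
    have main : ∀ z, AnalyticAt ℂ f z → lapl u z = lapl v z := by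
      intro z hz
      have hvc : ContinuousAt v z := c1.continuous.continuousAt.comp hz.continuousAt
      have t1 : Tendsto u (𝓝[≠] z) (𝓝 (u z)) := hu.continuous.continuousAt.continuousWithinAt
      have t2 : Tendsto v (𝓝[≠] z) (𝓝 (v z)) := hvc.continuousWithinAt
      have e0 : u z = v z := tendsto_nhds_unique t1 (t2.congr' (huv z))
      have e1 : u =ᶠ[𝓝 z] v := by
        have := huv z
        rw [EventuallyEq, eventually_nhdsWithin_iff] at this
        filter_upwards [this] with w hw
        by_cases hwz : w = z
        · rw [hwz, e0]
        · exact (hw hwz).symm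
      exact lapl_congr e1
    have hev : ∀ (s : Polynomial ℂ) (z : ℂ), AnalyticAt ℂ f z → AnalyticAt ℂ (fun w => s.eval (f w)) z := by
      intro s z hz
      simpa using hz.aeval_polynomial s
    rcases hmq.eventually_eq_zero_or_eventually_ne_zero with h | h
    · filter_upwards [ev_punct h, h, (hf z₀ trivial).eventually_analyticAt] with z h1 h2 h3
      have hq' : (fun w => q.eval (f w)) =ᶠ[𝓝 z] fun _ => 0 := h1
      have hg' : g =ᶠ[𝓝 z] fun _ => 0 := by
        filter_upwards [h1] with w hw
        rw [hg, hw, div_zero]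
      rw [main z h3, hv, lapl_HH hcop h3, hq'.deriv_eq, h2]
      simp [sph, hg'.deriv_eq]
      ring
    · filter_upwards [h, (hf z₀ trivial).eventually_analyticAt] with z h2 h3
      rw [main z h3, hv, lapl_HH hcop h3, sph_g_ne (hev p z h3) (hev q z h3) hg h2]
      ring

lemma sph_nonneg (f : ℂ → ℂ) (z : ℂ) : 0 ≤ sph f z := by unfold sph; positivity

lemma sph_ae_bound {f : ℂ → ℂ} (hf : MeromorphicOn f Set.univ) (r : ℝ) :
    ∃ C : ℝ, ∀ᵐ z ∂(volume.restrict (Metric.closedBall (0:ℂ) r)), sph f z ≤ C := by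
  apply (isCompact_closedBall (0:ℂ) r).induction_on (p := fun s => ∃ C : ℝ, ∀ᵐ z ∂(volume.restrict s), sph f z ≤ C)
  · exact ⟨0, by simp⟩
  · rintro s t hst ⟨C, hC⟩
    exact ⟨C, ae_restrict_of_ae_restrict_of_subset hst hC⟩
  · rintro s t ⟨C, hC⟩ ⟨D, hD⟩
    refine ⟨max C D, ?_⟩
    rw [ae_restrict_union_iff]
    exact ⟨hC.mono fun z hz => hz.trans (le_max_left _ _), hD.mono fun z hz => hz.trans (le_max_right _ _)⟩
  · intro z₀ _
    obtain ⟨C, hC⟩ := sph_bound (hf z₀ trivial)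
    rw [eventually_nhdsWithin_iff] at hC
    obtain ⟨s, hs, hso, hz⟩ := mem_nhds_iff.1 hC
    refine ⟨s, mem_nhdsWithin_of_mem_nhds (hso.mem_nhds hz), C, ?_⟩
    rw [ae_restrict_iff' hso.measurableSet]
    filter_upwards [(Set.countable_singleton z₀).ae_notMem volume] with z hne hzs
    exact hs hzs hne

lemma sph_meas {f : ℂ → ℂ} (hf : MeromorphicOn f Set.univ) : Measurable (sph f) := by
  have h1 : Measurable f := by
    have : Meromorphic f := fun z => hf z trivial
    exact this.measurable
  have h2 := measurable_deriv f
  unfold sph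
  fun_prop

lemma sph_integrableOn {f : ℂ → ℂ} (hf : MeromorphicOn f Set.univ) (r : ℝ) :
    IntegrableOn (sph f) (Metric.ball (0:ℂ) r) := by
  obtain ⟨C, hC⟩ := sph_ae_bound hf r
  have hC' := ae_restrict_of_ae_restrict_of_subset Metric.ball_subset_closedBall hC
  refine Measure.integrableOn_of_bounded (M := C) measure_ball_lt_top.ne (sph_meas hf).aestronglyMeasurable ?_
  filter_upwards [hC'] with z hz
  rwa [Real.norm_of_nonneg (sph_nonneg f z)]

lemma area_int {f : ℂ → ℂ} (hf : MeromorphicOn f Set.univ) {r : ℝ} (hr : 0 ≤ r) :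
    IntervalIntegrable (fun t => sphericalArea f t / t) volume 0 r := by
  have hmono : Monotone (sphericalArea f) := by
    intro s t hst
    unfold sphericalArea
    refine mul_le_mul_of_nonneg_left ?_ (by positivity)
    refine setIntegral_mono_set (sph_integrableOn hf t) (ae_of_all _ (sph_nonneg f)) ?_
    exact (Metric.ball_subset_ball hst).eventuallyLE
  obtain ⟨C, hC⟩ := sph_ae_bound hf r
  rw [intervalIntegrable_iff_integrableOn_Ioc_of_le hr]
  refine Measure.integrableOn_of_bounded (M := |C| * r) (by simp) (hmono.measurable.div measurable_id).aestronglyMeasurable ?_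
  refine (ae_restrict_iff' measurableSet_Ioc).2 (ae_of_all _ fun t ht => ?_)
  have hb : ‖∫ z in Metric.ball (0:ℂ) t, sph f z‖ ≤ |C| * volume.real (Metric.ball (0:ℂ) t) := by
    refine norm_setIntegral_le_of_norm_le_const_ae measure_ball_lt_top ?_
    have := ae_restrict_of_ae_restrict_of_subset (Metric.ball_subset_closedBall.trans (Metric.closedBall_subset_closedBall ht.2)) hC
    filter_upwards [this] with z hz
    rw [Real.norm_of_nonneg (sph_nonneg f z)]
    exact hz.trans (le_abs_self C)
  have hvol : volume.real (Metric.ball (0:ℂ) t) = t ^ 2 * Real.pi := by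
    simp [Measure.real, Complex.volume_ball, ht.1.le]
  rw [hvol] at hb
  have ht0 := ht.1
  have hpi := Real.pi_pos
  have e : sphericalArea f t = (1 / Real.pi) * ∫ z in Metric.ball (0:ℂ) t, sph f z := rfl
  rw [e, norm_div, norm_mul, Real.norm_of_nonneg ht0.le, Real.norm_of_nonneg (by positivity : (0:ℝ) ≤ 1 / Real.pi), div_le_iff₀ ht0]
  calc 1 / Real.pi * ‖∫ z in Metric.ball (0:ℂ) t, sph f z‖ ≤ 1 / Real.pi * (|C| * (t ^ 2 * Real.pi)) := by gcongr
    _ = |C| * t * t := by field_simp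
    _ ≤ |C| * r * t := by gcongr; exact ht.2

/-- Valiron–Mokhon'ko for degree 2: if `g = M ∘ f` for a rational function `M` of degree 2,
then `T(r, g) = 2 T(r, f) + O(1)`. -/
theorem stmt_16 (f g : ℂ → ℂ) (p q : Polynomial ℂ)
    (hf : MeromorphicOn f Set.univ)
    (hfnc : ¬ ∃ c : ℂ, ∀ z : ℂ, f z = c)
    (hcop : IsCoprime p q)
    (hdeg : max p.natDegree q.natDegree = 2)
    (hg : ∀ z : ℂ, g z = p.eval (f z) / q.eval (f z)) :
    ∃ C : ℝ, ∀ r : ℝ, 1 ≤ r → |charT g r - 2 * charT f r| ≤ C := by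
  obtain ⟨u, B, hu, hB, hae⟩ := exists_u hf hcop hdeg hg
  refine ⟨B, fun r hr => ?_⟩
  have hr0 : 0 ≤ r := by linarith
  have hpi := Real.pi_pos
  have he := ee_cont
  have hfd := (cont_aux hu).1
  have harea : ∀ t : ℝ, 0 ≤ t → sphericalArea g t = 2 * sphericalArea f t + 1 / (4 * Real.pi) * (t * ∫ θ in (-Real.pi)..Real.pi, fderiv ℝ u (t * ee θ) (ee θ)) := by
    intro t ht
    have e : ∀ h : ℂ → ℂ, sphericalArea h t = (1 / Real.pi) * ∫ z in Metric.ball (0:ℂ) t, sph h z := fun _ => rfl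
    rw [e, e, integral_congr_ae (ae_restrict_of_ae hae), MeasureTheory.integral_add, MeasureTheory.integral_const_mul, MeasureTheory.integral_div, green hu ht]
    · field_simp
    · exact (sph_integrableOn hf t).const_mul 2
    · have := ((lapl_cont hu).continuousOn (s := Metric.closedBall (0:ℂ) t)).integrableOn_compact (μ := volume) (isCompact_closedBall _ _)
      exact (this.mono_set Metric.ball_subset_closedBall).div_const 4
  have hchar : charT g r = 2 * charT f r + 1 / (4 * Real.pi) * ((∫ θ in (-Real.pi)..Real.pi, u (r * ee θ)) - 2 * Real.pi * u 0) := by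
    rw [← mean_eq hu, charT, charT, ← intervalIntegral.integral_const_mul, ← intervalIntegral.integral_const_mul, ← intervalIntegral.integral_add]
    · refine intervalIntegral.integral_congr_ae (ae_of_all _ fun t ht => ?_)
      rw [Set.uIoc_of_le hr0] at ht
      have ht0 := ht.1
      rw [harea t ht0.le]
      field_simp
    · exact (area_int hf hr0).const_mul 2
    · apply Continuous.intervalIntegrable
      apply continuous_const.mul
      apply intervalIntegral.continuous_parametric_intervalIntegral_of_continuous'
      unfold Function.uncurry
      fun_prop
  have hb1 : |∫ θ in (-Real.pi)..Real.pi, u (r * ee θ)| ≤ B * |Real.pi - (-Real.pi)| := by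
    have h1 := intervalIntegral.norm_integral_le_of_norm_le_const (f := fun θ => u (r * ee θ)) (a := -Real.pi) (b := Real.pi) (C := B) (fun θ _ => by
      rw [Real.norm_eq_abs]
      exact hB _)
    rwa [Real.norm_eq_abs] at h1
  have e2 : |Real.pi - (-Real.pi)| = 2 * Real.pi := by rw [abs_of_pos (by linarith)]; ring
  rw [e2] at hb1
  have hb2 : |2 * Real.pi * u 0| ≤ 2 * Real.pi * B := by
    rw [abs_mul, abs_of_pos (by linarith : 0 < 2 * Real.pi)]
    have := hB 0
    gcongr
  rw [hchar, add_sub_cancel_left, abs_mul, abs_of_pos (by positivity)]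
  calc _ ≤ 1 / (4 * Real.pi) * (B * (2 * Real.pi) + 2 * Real.pi * B) := by
        gcongr
        rw [abs_le] at hb1 hb2 ⊢
        constructor <;> linarith [hb1.1, hb1.2, hb2.1, hb2.2]
    _ = B := by field_simp; ring
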